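/- arXiv:math/0608360 — 2 statements merged into one kernel-verified Lean document; each statement's English description precedes it below -/
import Mathlib

section
/- Chip-firing solvability theorem: Let G be a graph of genus g. (1) Every divisor D on G with deg(D) ≥ g is linearly equivalent to an effective divisor (so the chip-firing game with initial configuration D has a winning strategy). (2) For every integer N ≤ g − 1 there exists a divisor of degree N on G that is not linearly equivalent to any effective divisor (an initial configuration with N total dollars for which no winning strategy exists). -/
open Finset

variable {V : Type}

/-- Degree of a vertex in the multigraph with edge multiplicities `m`. -/
def mdeg [Fintype V] (m : V → V → ℕ) (v : V) : ℕ := ∑ w, m v w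

/-- The Laplacian of an integer-valued function on the vertices. -/
def laplacian [Fintype V] (m : V → V → ℕ) (f : V → ℤ) : V → ℤ :=
  fun v => (mdeg m v : ℤ) * f v - ∑ w, (m v w : ℤ) * f w

/-- Linear equivalence of divisors. -/
def LinEquiv [Fintype V] (m : V → V → ℕ) (D D' : V → ℤ) : Prop :=
  ∃ f : V → ℤ, D - D' = laplacian m f

/-- A divisor is effective if it is nonnegative everywhere. -/
def Effective (D : V → ℤ) : Prop := ∀ v, 0 ≤ D v

/-- Degree of a divisor. -/
def divDeg [Fintype V] (D : V → ℤ) : ℤ := ∑ v, D v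

/-- `D` is linearly equivalent to some effective divisor. -/
def Winnable [Fintype V] (m : V → V → ℕ) (D : V → ℤ) : Prop :=
  ∃ E, Effective E ∧ LinEquiv m D E

/-- Number of edges of the multigraph. -/
def edgeCount [Fintype V] (m : V → V → ℕ) : ℤ := (∑ v, ∑ w, (m v w : ℤ)) / 2

/-- The genus `g = |E| - |V| + 1`. -/
def genus [Fintype V] (m : V → V → ℕ) : ℤ := edgeCount m - Fintype.card V + 1

/-- `m` describes a graph: symmetric, loopless, and connected. -/
def IsGraph [Fintype V] (m : V → V → ℕ) : Prop :=
  (∀ v w, m v w = m w v) ∧ (∀ v, m v v = 0) ∧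
  (SimpleGraph.fromRel (fun v w => 0 < m v w)).Connected


theorem lap_eq [Fintype V] (m : V → V → ℕ) (f : V → ℤ) (v : V) :
    laplacian m f v = ∑ w, (m v w : ℤ) * (f v - f w) := by
  simp only [laplacian, mdeg, mul_sub, Finset.sum_sub_distrib, Nat.cast_sum, Finset.sum_mul]

theorem sum_lap [Fintype V] (m : V → V → ℕ) (hs : ∀ v w, m v w = m w v) (f : V → ℤ) :
    ∑ v, laplacian m f v = 0 := by
  have h1 : ∑ v, laplacian m f v = ∑ v, ∑ w, (m v w : ℤ) * (f v - f w) :=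
    Finset.sum_congr rfl fun v _ => lap_eq m f v
  have h2 : ∑ v, ∑ w, (m v w : ℤ) * (f v - f w) = - ∑ v, ∑ w, (m v w : ℤ) * (f v - f w) := by
    conv_lhs => rw [Finset.sum_comm]
    rw [← Finset.sum_neg_distrib]
    refine Finset.sum_congr rfl fun v _ => ?_
    rw [← Finset.sum_neg_distrib]
    refine Finset.sum_congr rfl fun w _ => ?_
    rw [hs w v]; ring
  omega

theorem exists_h [Fintype V] (m : V → V → ℕ) (hm : IsGraph m) (q : V) :
    ∃ h : V → ℤ, h q = 0 ∧ ∀ v, v ≠ q → 1 ≤ laplacian m h v := by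
  obtain ⟨hs, hl, hc⟩ := hm
  set G := SimpleGraph.fromRel (fun v w => 0 < m v w) with hG
  let K : ℕ := (∑ v, mdeg m v) + 1
  let n : ℕ := ∑ v, G.dist v q
  let u : V → ℤ := fun v => (K : ℤ) ^ (n - G.dist v q)
  have hK : (1 : ℤ) ≤ K := by
    have : 1 ≤ K := Nat.le_add_left 1 _
    exact_mod_cast this
  have hu : ∀ v, 1 ≤ u v := fun v => one_le_pow₀ hK
  refine ⟨fun v => u q - u v, by simp, fun v hv => ?_⟩
  rw [lap_eq]
  obtain ⟨p, hp⟩ := hc.exists_walk_length_eq_dist v q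
  cases p with
  | nil => exact absurd rfl hv
  | @cons _ w _ hadj p =>
    have hd : G.dist w q ≤ p.length := SimpleGraph.dist_le p
    have hdn : G.dist v q ≤ n :=
      Finset.single_le_sum (f := fun v => G.dist v q) (fun _ _ => Nat.zero_le _) (Finset.mem_univ v)
    simp only [SimpleGraph.Walk.length_cons] at hp
    have hw : (K : ℤ) * u v ≤ u w := by
      simp only [u]
      rw [← pow_succ']
      exact pow_le_pow_right₀ hK (by omega)
    have hmw : (1 : ℤ) ≤ m v w := by
      rw [hG, SimpleGraph.fromRel_adj] at hadj
      have := hs v w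
      have := hadj.2
      omega
    have e1 : ∑ x, (m v x : ℤ) * (u q - u v - (u q - u x))
        = ∑ x, (m v x : ℤ) * u x - (mdeg m v : ℤ) * u v := by
      simp only [mdeg, Nat.cast_sum, Finset.sum_mul, ← Finset.sum_sub_distrib]
      exact Finset.sum_congr rfl fun x _ => by ring
    have e2 : (m v w : ℤ) * u w ≤ ∑ x, (m v x : ℤ) * u x :=
      Finset.single_le_sum (f := fun x => (m v x : ℤ) * u x)
        (fun x _ => mul_nonneg (by positivity) (by linarith [hu x])) (Finset.mem_univ w)
    have e3 : mdeg m v + 1 ≤ K := by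
      have : mdeg m v ≤ ∑ v, mdeg m v :=
        Finset.single_le_sum (f := fun v => mdeg m v) (fun _ _ => Nat.zero_le _) (Finset.mem_univ v)
      simp only [K]; omega
    have e4 : (mdeg m v : ℤ) + 1 ≤ K := by exact_mod_cast e3
    have := hu v
    have := hu w
    rw [e1]
    nlinarith

theorem lap_lin [Fintype V] (m : V → V → ℕ) (a : ℤ) (f h : V → ℤ) (v : V) :
    laplacian m (fun x => a * h x + f x) v = a * laplacian m h v + laplacian m f v := by
  simp only [lap_eq, Finset.mul_sum, ← Finset.sum_add_distrib]
  exact Finset.sum_congr rfl fun x _ => by ring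

theorem part_one [Fintype V] (m : V → V → ℕ) (hm : IsGraph m) (D : V → ℤ)
    (hD : genus m ≤ divDeg D) : Winnable m D := by
  classical
  obtain ⟨q⟩ := hm.2.2.nonempty
  obtain ⟨h, hq, hh⟩ := exists_h m hm q
  obtain ⟨hs, hl, -⟩ := hm
  let S : (V → ℤ) → Prop := fun f => f q = 0 ∧ ∀ v, v ≠ q → 0 ≤ D v - laplacian m f v
  let M : ℤ := ∑ v, |D v|
  have hM : ∀ v, |D v| ≤ M := fun v =>
    Finset.single_le_sum (f := fun v => |D v|) (fun _ _ => abs_nonneg _) (Finset.mem_univ v)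
  have hM0 : 0 ≤ M := Finset.sum_nonneg fun _ _ => abs_nonneg _
  have hne : S (fun x => (-M) * h x + 0) := by
    refine ⟨by simp [hq], fun v hv => ?_⟩
    rw [lap_lin m (-M) (fun _ => 0) h v]
    have h0 : laplacian m (fun _ => (0:ℤ)) v = 0 := by simp [lap_eq]
    rw [h0]
    have := hh v hv
    have := neg_abs_le (D v)
    have := hM v
    nlinarith
  have hbd : ∀ f, S f → ∀ v, f v ≤ (M + 1) * h v := by
    intro f hf v
    let g : V → ℤ := fun x => (M + 1) * h x + (-1 * f x + 0)
    obtain ⟨x, -, hx⟩ := Finset.exists_min_image Finset.univ g ⟨q, Finset.mem_univ q⟩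
    have hxq : x = q := by
      by_contra hxq
      have h1 : laplacian m g x ≤ 0 := by
        rw [lap_eq]
        refine Finset.sum_nonpos fun w _ => mul_nonpos_of_nonneg_of_nonpos (by positivity) ?_
        have := hx w (Finset.mem_univ w)
        linarith
      have h2 : laplacian m g x = (M + 1) * laplacian m h x + (-1 * laplacian m f x + 0) := by
        have h0 : laplacian m (fun _ => (0:ℤ)) x = 0 := by simp [lap_eq]
        rw [lap_lin m (M+1) (fun x => -1 * f x + 0) h x, lap_lin m (-1) (fun _ => 0) f x, h0]
      have := hf.2 x hxq
      have := hh x hxq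
      have := le_abs_self (D x)
      have := hM x
      nlinarith
    have h3 := hx v (Finset.mem_univ v)
    subst hxq
    simp only [g, hq, hf.1] at h3
    linarith
  obtain ⟨s, ⟨f, hf, hfs⟩, hmax⟩ := Int.exists_greatest_of_bdd
    (P := fun s => ∃ f, S f ∧ ∑ v, f v = s)
    ⟨∑ v, (M + 1) * h v, by
      rintro z ⟨f, hf, rfl⟩
      exact Finset.sum_le_sum fun v _ => hbd f hf v⟩
    ⟨_, (fun x => (-M) * h x + 0), hne, rfl⟩
  refine ⟨fun v => D v - laplacian m f v, ?_, f, by ext v; simp⟩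
  set E : V → ℤ := fun v => D v - laplacian m f v with hE
  by_contra hneg
  have hEq : E q ≤ -1 := by
    by_contra hc
    apply hneg
    intro v
    by_cases hv : v = q
    · subst hv; omega
    · exact hf.2 v hv
  have hdeg : ∑ v, E v = divDeg D := by
    simp only [hE, Finset.sum_sub_distrib, sum_lap m hs, divDeg, sub_zero]
  let P : Finset V → Prop := fun B =>
    q ∈ B ∧ 2 * ∑ v ∈ B, E v + 2 * (B.card : ℤ) ≤ ∑ v ∈ B, ∑ w ∈ B, (m v w : ℤ)
  have hP0 : P {q} := by
    refine ⟨by simp, ?_⟩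
    simp [hl]; omega
  obtain ⟨B, hB, hBmax⟩ := Finset.exists_max_image (Finset.univ.filter P) Finset.card
    ⟨{q}, by simp [hP0]⟩
  have hPB : P B := by simpa using hB
  have hBu : B = Finset.univ := by
    by_contra hBn
    have hcard : ∀ v, v ∉ B → ¬ P (insert v B) := by
      intro v hv hp
      have := hBmax _ (Finset.mem_filter.2 ⟨Finset.mem_univ _, hp⟩)
      rw [Finset.card_insert_of_notMem hv] at this
      omega
    let c : V → ℤ := fun x => if x ∈ B then 0 else 1
    have hnS : ¬ S (fun x => 1 * c x + f x) := by
      intro hS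
      have h1 := hmax _ ⟨(fun x => 1 * c x + f x), hS, rfl⟩
      rw [← hfs, Finset.sum_add_distrib] at h1
      obtain ⟨v, hv⟩ : ∃ v, v ∉ B := by
        by_contra hcon
        push Not at hcon
        exact hBn (Finset.eq_univ_iff_forall.2 hcon)
      have h2 : 1 * c v ≤ ∑ v, 1 * c v :=
        Finset.single_le_sum (f := fun v => 1 * c v)
          (fun x _ => by simp only [c]; split_ifs <;> simp) (Finset.mem_univ v)
      have h3 : c v = 1 := by simp [c, hv]
      rw [h3] at h2
      linarith
    apply hnS
    refine ⟨by simp [c, hPB.1, hf.1], fun v hvq => ?_⟩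
    rw [lap_lin m 1 f c v]
    have hEv : 0 ≤ E v := hf.2 v hvq
    suffices laplacian m c v ≤ E v by simp only [hE] at this; linarith
    by_cases hv : v ∈ B
    · refine le_trans ?_ hEv
      rw [lap_eq]
      refine Finset.sum_nonpos fun w _ => mul_nonpos_of_nonneg_of_nonpos (by positivity) ?_
      simp only [c, hv]; split_ifs <;> simp
    · by_contra hlt
      apply hcard v hv
      have hlap : laplacian m c v = ∑ w ∈ B, (m v w : ℤ) := by
        rw [lap_eq, ← Finset.sum_subset (Finset.subset_univ B)]
        · exact Finset.sum_congr rfl fun w hw => by simp [c, hv, hw]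
        · intro w _ hw; simp [c, hv, hw]
      rw [hlap] at hlt
      refine ⟨by simp [hPB.1], ?_⟩
      have h4 := hPB.2
      rw [Finset.sum_insert hv, Finset.sum_insert hv, Finset.card_insert_of_notMem hv]
      simp only [Finset.sum_insert hv, Finset.sum_add_distrib, hl]
      have h5 : ∑ x ∈ B, (m x v : ℤ) = ∑ x ∈ B, (m v x : ℤ) :=
        Finset.sum_congr rfl fun x _ => by rw [hs]
      rw [h5]
      push_cast
      push Not at hlt
      linarith
  have h6 := hPB.2
  rw [hBu, hdeg, Finset.card_univ] at h6
  unfold genus edgeCount at hD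
  omega

theorem part_two [Fintype V] (m : V → V → ℕ) (hm : IsGraph m) (N : ℤ)
    (hN : N ≤ genus m - 1) : ∃ D : V → ℤ, divDeg D = N ∧ ¬ Winnable m D := by
  classical
  obtain ⟨q⟩ := hm.2.2.nonempty
  obtain ⟨hs, hl, -⟩ := hm
  let e := Fintype.equivFin V
  let b : V → ℤ := fun v => ∑ w, if e w < e v then (m v w : ℤ) else 0
  have hsum : ∑ v, ∑ w, (m v w : ℤ) = 2 * ∑ v, b v := by
    have h1 : ∑ v, b v = ∑ v, ∑ w, if e v < e w then (m v w : ℤ) else 0 := by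
      simp only [b]
      rw [Finset.sum_comm]
      exact Finset.sum_congr rfl fun v _ => Finset.sum_congr rfl fun w _ => by rw [hs w v]
    have h2 : ∑ v, ∑ w, (m v w : ℤ) = ∑ v, b v + ∑ v, ∑ w, if e v < e w then (m v w : ℤ) else 0 := by
      simp only [b, ← Finset.sum_add_distrib]
      refine Finset.sum_congr rfl fun v _ => Finset.sum_congr rfl fun w _ => ?_
      rcases lt_trichotomy (e v) (e w) with h | h | h
      · simp [h, h.le]
      · have := e.injective h
        subst this
        simp [hl]
      · simp [h, h.le]
    rw [h2, ← h1]; ring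
  have hg : genus m - 1 = ∑ v, b v - Fintype.card V := by
    unfold genus edgeCount
    rw [hsum]; omega
  refine ⟨fun v => b v - 1 - if v = q then genus m - 1 - N else 0, ?_, ?_⟩
  · simp only [divDeg, Finset.sum_sub_distrib]
    simp
    linarith
  · rintro ⟨E, hE, f, hf⟩
    obtain ⟨x, -, hx⟩ := Finset.exists_max_image Finset.univ f ⟨q, Finset.mem_univ q⟩
    obtain ⟨v, hv, hvmin⟩ := Finset.exists_min_image (Finset.univ.filter fun v => f v = f x) e
      ⟨x, by simp⟩
    have hvx : f v = f x := by simpa using hv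
    have h1 := congrFun hf v
    rw [lap_eq] at h1
    simp only [Pi.sub_apply] at h1
    have h2 : b v ≤ ∑ w, (m v w : ℤ) * (f v - f w) := by
      refine Finset.sum_le_sum fun w _ => ?_
      have h3 := hx w (Finset.mem_univ w)
      split_ifs with hlt
      · have h4 : f w ≠ f x := fun h => absurd (hvmin w (by simp [h])) (not_le.2 hlt)
        have h5 : 1 ≤ f v - f w := by omega
        have : (0:ℤ) ≤ m v w := by positivity
        nlinarith
      · exact mul_nonneg (by positivity) (by omega)
    have := hE v
    split_ifs at h1 <;> omega

theorem chip_firing_winnability [Fintype V] (m : V → V → ℕ) (hm : IsGraph m) :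
    (∀ D : V → ℤ, genus m ≤ divDeg D → Winnable m D) ∧
    (∀ N : ℤ, N ≤ genus m - 1 → ∃ D : V → ℤ, divDeg D = N ∧ ¬ Winnable m D) := by
  exact ⟨part_one m hm, part_two m hm⟩
end

section
/- Borrowing lemma: Let G be a graph and D ∈ Div(G). Then D is linearly equivalent to an effective divisor if and only if there is a finite sequence of divisors D = D_0, D_1, …, D_k such that D_k is effective and, for each 0 ≤ i < k, there is a vertex v_i with D_i(v_i) < 0 and D_{i+1} = D_i + Δ(χ_{{v_i}}) (i.e., a winning strategy exists if and only if one exists in which only vertices that are in debt ever borrow). -/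
open Finset

variable {V : Type}

theorem laplacian_add [Fintype V] (m : V → V → ℕ) (f g : V → ℤ) :
    laplacian m (f + g) = laplacian m f + laplacian m g := by
  funext v
  simp only [laplacian, Pi.add_apply, mul_add, Finset.sum_add_distrib]
  ring

theorem laplacian_neg [Fintype V] (m : V → V → ℕ) (f : V → ℤ) :
    laplacian m (-f) = - laplacian m f := by
  funext v
  simp only [laplacian, Pi.neg_apply, mul_neg, Finset.sum_neg_distrib]
  ring

theorem laplacian_const [Fintype V] (m : V → V → ℕ) (c : ℤ) :
    laplacian m (fun _ => c) = 0 := by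
  funext v
  simp only [laplacian, mdeg, Pi.zero_apply, ← Finset.sum_mul]
  push_cast
  ring

theorem borrow_aux [Fintype V] [DecidableEq V] (m : V → V → ℕ) (n : ℕ) :
    ∀ (D f : V → ℤ), (∀ v, 0 ≤ f v) → ∑ v, f v = n → Effective (D + laplacian m f) →
      ∃ (k : ℕ) (s : ℕ → V → ℤ), s 0 = D ∧ Effective (s k) ∧
        ∀ i, i < k → ∃ v : V, s i v < 0 ∧
          s (i + 1) = s i + laplacian m (fun w => if w = v then 1 else 0) := by
  induction n with
  | zero =>
    intro D f hf hs hE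
    have h0 : f = fun _ => 0 := by
      funext v
      exact (Finset.sum_eq_zero_iff_of_nonneg (fun v _ => hf v)).1 (by simpa using hs) v
        (Finset.mem_univ v)
    rw [h0, laplacian_const, add_zero] at hE
    exact ⟨0, fun _ => D, rfl, hE, fun i hi => absurd hi (Nat.not_lt_zero i)⟩
  | succ n ih =>
    intro D f hf hs hE
    by_cases hD : Effective D
    · exact ⟨0, fun _ => D, rfl, hD, fun i hi => absurd hi (Nat.not_lt_zero i)⟩
    · unfold Effective at hD
      push Not at hD
      obtain ⟨v, hv⟩ := hD
      have hfv : 1 ≤ f v := by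
        by_contra hlt
        have h0 : f v = 0 := by have := hf v; omega
        have h1 := hE v
        have h2 : 0 ≤ ∑ w, (m v w : ℤ) * f w :=
          Finset.sum_nonneg fun w _ => mul_nonneg (by positivity) (hf w)
        simp only [Pi.add_apply, laplacian, h0, mul_zero] at h1
        linarith
      set e : V → ℤ := fun w => if w = v then 1 else 0 with he
      have hfe : f = e + (f + -e) := by abel
      obtain ⟨k, s, hs0, hk, hstep⟩ := ih (D + laplacian m e) (f + -e)
        (by
          intro w
          by_cases hw : w = v
          · subst hw; simp [he]; omega
          · simpa [he, hw] using hf w)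
        (by
          simp only [Pi.add_apply, Pi.neg_apply, Finset.sum_add_distrib, hs,
            Finset.sum_neg_distrib]
          simp [he])
        (by rw [add_assoc, ← laplacian_add, ← hfe]; exact hE)
      refine ⟨k + 1, fun i => Nat.casesOn i D s, rfl, hk, ?_⟩
      intro i hi
      cases i with
      | zero => exact ⟨v, hv, hs0⟩
      | succ i => exact hstep i (by omega)

theorem seq_aux [Fintype V] [DecidableEq V] (m : V → V → ℕ) (s : ℕ → V → ℤ) (k : ℕ)
    (h : ∀ i, i < k → ∃ v : V, s i v < 0 ∧
          s (i + 1) = s i + laplacian m (fun w => if w = v then 1 else 0)) :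
    ∃ f, s k = s 0 + laplacian m f := by
  induction k with
  | zero => exact ⟨fun _ => 0, by rw [laplacian_const, add_zero]⟩
  | succ k ih =>
    obtain ⟨f, hf⟩ := ih fun i hi => h i (by omega)
    obtain ⟨v, _, hv⟩ := h k (by omega)
    exact ⟨f + (fun w => if w = v then 1 else 0), by
      rw [hv, hf, laplacian_add, add_assoc]⟩

theorem borrowing_lemma [Fintype V] [DecidableEq V] (m : V → V → ℕ)
    (hm : IsGraph m) (D : V → ℤ) :
    Winnable m D ↔
      ∃ (k : ℕ) (s : ℕ → V → ℤ), s 0 = D ∧ Effective (s k) ∧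
        ∀ i, i < k → ∃ v : V, s i v < 0 ∧
          s (i + 1) = s i + laplacian m (fun w => if w = v then 1 else 0) := by
  constructor
  · rintro ⟨E, hE, f, hf⟩
    set c : ℤ := ∑ v, |f v| with hc
    have hnn : ∀ v, 0 ≤ (-f + (fun _ => c) : V → ℤ) v := by
      intro v
      have h1 : |f v| ≤ c := Finset.single_le_sum (f := fun v => |f v|)
        (fun w _ => abs_nonneg _) (Finset.mem_univ v)
      have h2 := le_abs_self (f v)
      simp only [Pi.add_apply, Pi.neg_apply]
      linarith
    refine borrow_aux m (∑ v, (-f + (fun _ => c) : V → ℤ) v).toNat D (-f + (fun _ => c) : V → ℤ) hnn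
      (Int.toNat_of_nonneg (Finset.sum_nonneg fun v _ => hnn v)).symm ?_
    rw [laplacian_add, laplacian_const, add_zero, laplacian_neg, ← hf]
    simpa using hE
  · rintro ⟨k, s, rfl, hk, h⟩
    obtain ⟨f, hf⟩ := seq_aux m s k h
    refine ⟨s k, hk, -f, ?_⟩
    rw [hf, laplacian_neg]
    abel
end
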